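/- Let β ∈ (0,3) and let a : ℕ → ℂ be a sequence with Σ_{k≥1} ((k−2)(k−1)k)² |a_k|² < ∞ and Σ_{k≥1} |a_k|² < ∞. Write g = (Σ_{k≥1} ((k−2)(k−1)k)² |a_k|²)^{1/2} and f = (Σ_{k≥1} |a_k|²)^{1/2}. Then (Σ_{k≥1} k^{2β} |a_k|²)^{1/2} ≤ 5^{β/3} g^{β/3} f^{1−β/3} + 65^{β/6} f. -/

import Mathlib

/-- Hölder's inequality for series, in its log-convexity form. -/
theorem summable_and_tsum_rpow_mul_rpow_le {ι : Type*} {u v : ι → ℝ} {θ : ℝ}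
    (hθ0 : 0 < θ) (hθ1 : θ < 1) (hu0 : ∀ i, 0 ≤ u i) (hv0 : ∀ i, 0 ≤ v i)
    (hu : Summable u) (hv : Summable v) :
    (Summable fun i => u i ^ θ * v i ^ (1 - θ)) ∧
      ∑' i, u i ^ θ * v i ^ (1 - θ) ≤ (∑' i, u i) ^ θ * (∑' i, v i) ^ (1 - θ) := by
  have hθ2 : 0 < 1 - θ := sub_pos.2 hθ1
  have hpq : (θ⁻¹).HolderConjugate (1 - θ)⁻¹ :=
    Real.holderConjugate_iff.2 ⟨(one_lt_inv₀ hθ0).2 hθ1, by simp⟩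
  have hu' : ∀ i, (u i ^ θ) ^ θ⁻¹ = u i := fun i => Real.rpow_rpow_inv (hu0 i) hθ0.ne'
  have hv' : ∀ i, (v i ^ (1 - θ)) ^ (1 - θ)⁻¹ = v i :=
    fun i => Real.rpow_rpow_inv (hv0 i) hθ2.ne'
  have h := Real.summable_and_inner_le_Lp_mul_Lq_tsum_of_nonneg hpq
    (fun i => Real.rpow_nonneg (hu0 i) θ) (fun i => Real.rpow_nonneg (hv0 i) (1 - θ))
    (by simpa only [hu'] using hu) (by simpa only [hv'] using hv)
  simpa only [hu', hv', one_div, inv_inv] using h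

theorem succ_pow_six_le (k : ℕ) :
    ((k : ℝ) + 1) ^ 6 ≤
      25 * ((((k : ℝ) + 1) - 2) * (((k : ℝ) + 1) - 1) * ((k : ℝ) + 1)) ^ 2 + 65 := by
  rcases k with _ | _ | n
  · norm_num
  · norm_num
  · push_cast
    have hn : (0 : ℝ) ≤ n := n.cast_nonneg
    have hn2 : 0 ≤ 4 * (n : ℝ) ^ 2 + 9 * n + 1 := by positivity
    have h : ((n : ℝ) + 1 + 1 + 1) ^ 3 ≤
        5 * (((n : ℝ) + 1 + 1 + 1 - 2) * ((n : ℝ) + 1 + 1 + 1 - 1) * ((n : ℝ) + 1 + 1 + 1)) := by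
      nlinarith [mul_nonneg (by positivity : (0 : ℝ) ≤ n + 3) hn2]
    have h2 := pow_le_pow_left₀ (by positivity) h 2
    nlinarith [h2]

/-- The scalar estimate turning a bound on squared norms into a bound on norms. -/
theorem sqrt_rpow_mul_rpow_le {G F θ : ℝ} (hG : 0 ≤ G) (hF : 0 ≤ F)
    (hθ0 : 0 < θ) (hθ1 : θ < 1) :
    √((25 * G + 65 * F) ^ θ * F ^ (1 - θ)) ≤
      5 ^ θ * √G ^ θ * √F ^ (1 - θ) + 65 ^ (θ / 2) * √F := by
  have hf : 0 ≤ √F := Real.sqrt_nonneg F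
  have sqrt_rpow : ∀ {x : ℝ} (t : ℝ), 0 ≤ x → √(x ^ t) = √x ^ t := fun {x} t hx => by
    rw [Real.sqrt_eq_rpow, Real.sqrt_eq_rpow, ← Real.rpow_mul hx, ← Real.rpow_mul hx, mul_comm]
  have hadd : √(25 * G + 65 * F) ≤ 5 * √G + √65 * √F := by
    have h25 : √(25 * G) = 5 * √G := by
      rw [Real.sqrt_mul (by norm_num), show (25 : ℝ) = 5 ^ 2 by norm_num,
        Real.sqrt_sq (by norm_num)]
    rw [← h25, ← Real.sqrt_mul (by norm_num)]
    simpa only [Real.sqrt_eq_rpow] using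
      Real.rpow_add_le_add_rpow (mul_nonneg (by norm_num) hG) (mul_nonneg (by norm_num) hF)
        (by norm_num : (0 : ℝ) ≤ 1 / 2) (by norm_num)
  have h65 : (√65 : ℝ) ^ θ = 65 ^ (θ / 2) := by
    rw [Real.sqrt_eq_rpow, ← Real.rpow_mul (by norm_num)]
    congr 1
    ring
  have hF1 : √F ^ θ * √F ^ (1 - θ) = √F := by
    rw [← Real.rpow_add' hf (by simp)]
    simp
  calc √((25 * G + 65 * F) ^ θ * F ^ (1 - θ))
      = √(25 * G + 65 * F) ^ θ * √F ^ (1 - θ) := by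
        rw [Real.sqrt_mul (by positivity), sqrt_rpow _ (by positivity), sqrt_rpow _ hF]
    _ ≤ (5 * √G + √65 * √F) ^ θ * √F ^ (1 - θ) := by gcongr
    _ ≤ ((5 * √G) ^ θ + (√65 * √F) ^ θ) * √F ^ (1 - θ) := by
        gcongr
        exact Real.rpow_add_le_add_rpow (by positivity) (by positivity) hθ0.le hθ1.le
    _ = 5 ^ θ * √G ^ θ * √F ^ (1 - θ) + 65 ^ (θ / 2) * (√F ^ θ * √F ^ (1 - θ)) := by
        rw [Real.mul_rpow (by norm_num) (by positivity),
          Real.mul_rpow (by positivity) (by positivity), h65]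
        ring
    _ = _ := by rw [hF1]


/-- Second inequality of Lemma 3.2(ii):
`‖H₀^β φ‖ ≤ 5^{β/3} ‖Gφ‖^{β/3} ‖φ‖^{1-β/3} + 65^{β/6} ‖φ‖` for `β ∈ (0,3)`,
expressed in terms of the coefficient sequence `a k = ⟨φ, e k⟩`, where
`g = ‖Gφ‖` and `f = ‖φ‖`. -/
theorem coeff_H0_pow_beta_le_G (β : ℝ) (hβ : β ∈ Set.Ioo (0 : ℝ) 3) (a : ℕ → ℂ)
    (hg : Summable fun k : ℕ =>
      ((((k : ℝ) + 1) - 2) * (((k : ℝ) + 1) - 1) * ((k : ℝ) + 1)) ^ 2 * ‖a (k + 1)‖ ^ 2)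
    (hf : Summable fun k : ℕ => ‖a (k + 1)‖ ^ 2) :
    (Summable fun k : ℕ => ((k : ℝ) + 1) ^ (2 * β) * ‖a (k + 1)‖ ^ 2) ∧
      Real.sqrt (∑' k : ℕ, ((k : ℝ) + 1) ^ (2 * β) * ‖a (k + 1)‖ ^ 2) ≤
        (5 : ℝ) ^ (β / 3) *
            (Real.sqrt (∑' k : ℕ,
              ((((k : ℝ) + 1) - 2) * (((k : ℝ) + 1) - 1) * ((k : ℝ) + 1)) ^ 2
                * ‖a (k + 1)‖ ^ 2)) ^ (β / 3) *
            (Real.sqrt (∑' k : ℕ, ‖a (k + 1)‖ ^ 2)) ^ (1 - β / 3)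
          + (65 : ℝ) ^ (β / 6) * Real.sqrt (∑' k : ℕ, ‖a (k + 1)‖ ^ 2) := by
  obtain ⟨hβ0, hβ3⟩ := hβ
  have hθ0 : 0 < β / 3 := by positivity
  have hθ1 : β / 3 < 1 := by linarith
  have hu := (hg.mul_left 25).add (hf.mul_left 65)
  obtain ⟨hs, hle⟩ := summable_and_tsum_rpow_mul_rpow_le hθ0 hθ1
    (fun k => by positivity) (fun k => by positivity) hu hf
  have hpt : ∀ k : ℕ, ((k : ℝ) + 1) ^ (2 * β) * ‖a (k + 1)‖ ^ 2 ≤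
      (25 * (((((k : ℝ) + 1) - 2) * (((k : ℝ) + 1) - 1) * ((k : ℝ) + 1)) ^ 2
        * ‖a (k + 1)‖ ^ 2) + 65 * ‖a (k + 1)‖ ^ 2) ^ (β / 3)
        * (‖a (k + 1)‖ ^ 2) ^ (1 - β / 3) := fun k => by
    have hk : ((k : ℝ) + 1) ^ (2 * β) = (((k : ℝ) + 1) ^ 6) ^ (β / 3) := by
      rw [← Real.rpow_natCast, ← Real.rpow_mul (by positivity)]
      congr 1
      push_cast
      ring
    have ha : (‖a (k + 1)‖ ^ 2) ^ (β / 3) * (‖a (k + 1)‖ ^ 2) ^ (1 - β / 3)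
        = ‖a (k + 1)‖ ^ 2 := by
      rw [← Real.rpow_add' (by positivity) (by simp), add_sub_cancel, Real.rpow_one]
    rw [← mul_assoc, ← add_mul, Real.mul_rpow (by positivity) (by positivity), mul_assoc, ha, hk]
    gcongr
    exact succ_pow_six_le k
  have hsum := Summable.of_nonneg_of_le (fun k => by positivity) hpt hs
  refine ⟨hsum, ?_⟩
  have htsum := (hsum.tsum_le_tsum hpt hs).trans hle
  rw [(hg.mul_left 25).tsum_add (hf.mul_left 65), tsum_mul_left, tsum_mul_left] at htsum
  have hfin := sqrt_rpow_mul_rpow_le (tsum_nonneg fun k => by positivity)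
    (tsum_nonneg fun k => by positivity) hθ0 hθ1 |>.trans' (Real.sqrt_le_sqrt htsum)
  rwa [show β / 3 / 2 = β / 6 by ring] at hfin
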